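/- arXiv:1405.4537 — 3 statements merged into one kernel-verified Lean document; each statement's English description precedes it below -/
import Mathlib

section
/- Let F be a real Banach space, let A : ℝ^d → (F →L F) be a continuous linear map into the bounded linear operators on F with operator norm ‖A‖ (as a map from ℝ^d with Euclidean norm to operators with operator norm), let γ : [a,b] → ℝ^d be a C¹ path of length L = ∫_a^b ‖γ'(u)‖ du, and let y : [a,b] → F be differentiable with y'(t) = A(γ'(t))(y(t)). Then for every N ≥ 0, ‖ y(b) − Σ_{n=0}^{N−1} Σ_{w=(i₁,…,iₙ)} S^w_{a,b}(γ) · (A(e_{iₙ}) ∘ ⋯ ∘ A(e_{i₁}))(y(a)) ‖ ≤ ( Σ_{n=N}^∞ ‖A‖ⁿ Lⁿ / n! ) · ‖y(a)‖, where the inner sum is over all words of length n over {1,…,d} and e_i is the i-th standard basis vector of ℝ^d. -/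
open MeasureTheory intervalIntegral Set Filter

/-- Signature coefficients of a path, indexed by words over `Fin d`. -/
noncomputable def sig {d : ℕ} (γ : ℝ → EuclideanSpace ℝ (Fin d)) :
    List (Fin d) → ℝ → ℝ → ℝ
  | [], _, _ => 1
  | i :: w, s, t => ∫ u in s..t, deriv γ u i * sig γ w u t

/-- Given `A` sending vectors of `ℝ^d` to bounded operators on `F`, the operator
`A(e_{iₙ}) ∘ ⋯ ∘ A(e_{i₁})` associated to the word `(i₁,…,iₙ)`. -/
noncomputable def wordOp {d : ℕ} {F : Type*} [NormedAddCommGroup F] [NormedSpace ℝ F]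
    (A : EuclideanSpace ℝ (Fin d) → (F →L[ℝ] F)) : List (Fin d) → (F →L[ℝ] F)
  | [] => ContinuousLinearMap.id ℝ F
  | i :: w => (wordOp A w).comp (A (EuclideanSpace.single i 1))

/-- Mean value inequality with a comparison function whose derivative dominates. -/
theorem norm_sub_le_sub_of_norm_deriv_le {E : Type*} [NormedAddCommGroup E] [NormedSpace ℝ E]
    {f f' : ℝ → E} {B B' : ℝ → ℝ} {a b : ℝ} (hab : a ≤ b)
    (hf : ∀ t ∈ Icc a b, HasDerivAt f (f' t) t)
    (hB : ∀ t ∈ Icc a b, HasDerivAt B (B' t) t)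
    (bound : ∀ t ∈ Icc a b, ‖f' t‖ ≤ B' t) : ‖f b - f a‖ ≤ B b - B a :=
  image_norm_le_of_norm_deriv_right_le_deriv_boundary' (f := fun t => f t - f a) (f' := f')
    (B := fun t => B t - B a) (B' := B')
    (fun t ht => ((hf t ht).sub_const _).continuousAt.continuousWithinAt)
    (fun t ht => ((hf t (Ico_subset_Icc_self ht)).sub_const _).hasDerivWithinAt)
    (by simp)
    (fun t ht => ((hB t ht).sub_const _).continuousAt.continuousWithinAt)
    (fun t ht => ((hB t (Ico_subset_Icc_self ht)).sub_const _).hasDerivWithinAt)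
    (fun t ht => bound t (Ico_subset_Icc_self ht)) (right_mem_Icc.2 hab)

/-- Grönwall inequality with a time-dependent rate. -/
theorem norm_le_exp_mul_of_norm_deriv_le {E : Type*} [NormedAddCommGroup E] [NormedSpace ℝ E]
    {y y' : ℝ → E} {m m' : ℝ → ℝ} {a b : ℝ}
    (hy : ∀ t ∈ Icc a b, HasDerivAt y (y' t) t)
    (hm : ∀ t ∈ Icc a b, HasDerivAt m (m' t) t)
    (bound : ∀ t ∈ Icc a b, ‖y' t‖ ≤ m' t * ‖y t‖) {t : ℝ} (ht : t ∈ Icc a b) :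
    ‖y t‖ ≤ Real.exp (m t - m a) * ‖y a‖ := by
  have key : ∀ ε > 0, ‖y t‖ ≤ Real.exp (m t - m a + ε * (t - a)) * (‖y a‖ + ε) := by
    intro ε hε
    have hB : ∀ s ∈ Icc a b,
        HasDerivAt (fun s => Real.exp (m s - m a + ε * (s - a)) * (‖y a‖ + ε))
          (Real.exp (m s - m a + ε * (s - a)) * (m' s + ε) * (‖y a‖ + ε)) s := by
      intro s hs
      have h := ((hm s hs).sub_const (m a)).add
        (((hasDerivAt_id s).sub_const a).const_mul ε)
      simpa using h.exp.mul_const (‖y a‖ + ε)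
    refine image_norm_le_of_norm_deriv_right_lt_deriv_boundary' (f' := y')
      (fun s hs => (hy s hs).continuousAt.continuousWithinAt)
      (fun s hs => (hy s (Ico_subset_Icc_self hs)).hasDerivWithinAt)
      (by simp [hε.le])
      (fun s hs => (hB s hs).continuousAt.continuousWithinAt)
      (fun s hs => (hB s (Ico_subset_Icc_self hs)).hasDerivWithinAt)
      (fun s hs heq => ?_) ht
    have h := bound s (Ico_subset_Icc_self hs)
    rw [heq] at h
    have hpos : 0 < Real.exp (m s - m a + ε * (s - a)) * (‖y a‖ + ε) := by positivity
    nlinarith [mul_pos hε hpos]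
  have hlim : Tendsto (fun ε : ℝ => Real.exp (m t - m a + ε * (t - a)) * (‖y a‖ + ε))
      (nhdsWithin 0 (Ioi 0)) (nhds (Real.exp (m t - m a) * ‖y a‖)) := by
    have hc : Continuous fun ε : ℝ =>
        Real.exp (m t - m a + ε * (t - a)) * (‖y a‖ + ε) := by fun_prop
    simpa using (hc.tendsto 0).mono_left nhdsWithin_le_nhds
  exact ge_of_tendsto hlim (eventually_nhdsWithin_of_forall key)

theorem hasDerivAt_integral_lower {E : Type*} [NormedAddCommGroup E] [NormedSpace ℝ E]
    [CompleteSpace E] {f : ℝ → E} (hf : Continuous f) (b s : ℝ) :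
    HasDerivAt (fun s => ∫ u in s..b, f u) (-f s) s :=
  integral_hasDerivAt_left (hf.intervalIntegrable _ _)
    (hf.stronglyMeasurableAtFilter _ _) hf.continuousAt

theorem continuous_sig {d : ℕ} {γ : ℝ → EuclideanSpace ℝ (Fin d)}
    (hγ : Continuous (deriv γ)) (b : ℝ) :
    ∀ w : List (Fin d), Continuous fun s => sig γ w s b
  | [] => continuous_const
  | i :: w => by
    have hc : Continuous fun u => deriv γ u i * sig γ w u b :=
      (by fun_prop : Continuous fun u => deriv γ u i).mul (continuous_sig hγ b w)
    exact continuous_iff_continuousAt.2 fun s => (hasDerivAt_integral_lower hc b s).continuousAt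

theorem hasDerivAt_sig_cons {d : ℕ} {γ : ℝ → EuclideanSpace ℝ (Fin d)}
    (hγ : Continuous (deriv γ)) (b s : ℝ) (i : Fin d) (w : List (Fin d)) :
    HasDerivAt (fun s => sig γ (i :: w) s b) (-(deriv γ s i * sig γ w s b)) s :=
  hasDerivAt_integral_lower (f := fun u => deriv γ u i * sig γ w u b)
    ((by fun_prop : Continuous fun u => deriv γ u i).mul (continuous_sig hγ b w)) b s

section SigLevel

variable {d : ℕ} {F : Type*} [NormedAddCommGroup F] [NormedSpace ℝ F]

/-- The level-`n` term of the signature expansion of the flow from time `s` to time `b`. -/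
noncomputable def sigLevel (A : EuclideanSpace ℝ (Fin d) →L[ℝ] (F →L[ℝ] F))
    (γ : ℝ → EuclideanSpace ℝ (Fin d)) (b : ℝ) (n : ℕ) (s : ℝ) : F →L[ℝ] F :=
  ∑ f : Fin n → Fin d, sig γ (List.ofFn f) s b • wordOp (fun e => A e) (List.ofFn f)

theorem sigLevel_zero (A : EuclideanSpace ℝ (Fin d) →L[ℝ] (F →L[ℝ] F))
    (γ : ℝ → EuclideanSpace ℝ (Fin d)) (b s : ℝ) :
    sigLevel A γ b 0 s = ContinuousLinearMap.id ℝ F := by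
  simp [sigLevel, sig, wordOp]

theorem sigLevel_succ (A : EuclideanSpace ℝ (Fin d) →L[ℝ] (F →L[ℝ] F))
    (γ : ℝ → EuclideanSpace ℝ (Fin d)) (b : ℝ) (n : ℕ) (s : ℝ) :
    sigLevel A γ b (n + 1) s = ∑ i : Fin d, ∑ f : Fin n → Fin d,
      sig γ (i :: List.ofFn f) s b • wordOp (fun e => A e) (i :: List.ofFn f) := by
  rw [sigLevel, ← (Fin.consEquiv fun _ => Fin d).sum_comp, Fintype.sum_prod_type]
  simp [Fin.consEquiv]

theorem sigLevel_succ_self (A : EuclideanSpace ℝ (Fin d) →L[ℝ] (F →L[ℝ] F))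
    (γ : ℝ → EuclideanSpace ℝ (Fin d)) (b : ℝ) (n : ℕ) :
    sigLevel A γ b (n + 1) b = 0 := by
  simp [sigLevel_succ, sig]

theorem sum_coord_smul_map_single (A : EuclideanSpace ℝ (Fin d) →L[ℝ] (F →L[ℝ] F))
    (v : EuclideanSpace ℝ (Fin d)) :
    ∑ i, v i • A (EuclideanSpace.single i 1) = A v := by
  have h := (EuclideanSpace.basisFun (Fin d) ℝ).sum_repr v
  conv_rhs => rw [← h]
  simp [map_sum]

theorem hasDerivAt_sigLevel_succ (A : EuclideanSpace ℝ (Fin d) →L[ℝ] (F →L[ℝ] F))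
    {γ : ℝ → EuclideanSpace ℝ (Fin d)} (hγ : Continuous (deriv γ)) (b : ℝ) (n : ℕ) (s : ℝ) :
    HasDerivAt (sigLevel A γ b (n + 1)) (-(sigLevel A γ b n s).comp (A (deriv γ s))) s := by
  have h : HasDerivAt (fun s => ∑ i : Fin d, ∑ f : Fin n → Fin d,
      sig γ (i :: List.ofFn f) s b • wordOp (fun e => A e) (i :: List.ofFn f))
      (∑ i : Fin d, ∑ f : Fin n → Fin d, (-(deriv γ s i * sig γ (List.ofFn f) s b)) •
        wordOp (fun e => A e) (i :: List.ofFn f)) s :=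
    HasDerivAt.fun_sum fun i _ => HasDerivAt.fun_sum fun f _ =>
      (hasDerivAt_sig_cons hγ b s i (List.ofFn f)).smul_const
        (wordOp (fun e => A e) (i :: List.ofFn f))
  convert h using 1
  · exact funext fun s => sigLevel_succ A γ b n s
  · ext x
    rw [← sum_coord_smul_map_single A (deriv γ s)]
    simp [sigLevel, wordOp, map_sum, Finset.smul_sum, smul_smul, mul_comm]

theorem hasDerivAt_pow_div_factorial {f : ℝ → ℝ} {f' s : ℝ} (hf : HasDerivAt f f' s) (n : ℕ) :
    HasDerivAt (fun s => f s ^ (n + 1) / ((n + 1).factorial : ℝ))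
      (f s ^ n / (n.factorial : ℝ) * f') s := by
  refine ((hf.fun_pow (n + 1)).div_const _).congr_deriv ?_
  rw [Nat.factorial_succ]
  have : (n.factorial : ℝ) ≠ 0 := by positivity
  push_cast
  field_simp

theorem norm_sigLevel_le (A : EuclideanSpace ℝ (Fin d) →L[ℝ] (F →L[ℝ] F))
    {γ : ℝ → EuclideanSpace ℝ (Fin d)} (hγ : Continuous (deriv γ)) (b : ℝ) (n : ℕ) :
    ∀ s ≤ b, ‖sigLevel A γ b n s‖ ≤
      (‖A‖ * ∫ u in s..b, ‖deriv γ u‖) ^ n / (n.factorial : ℝ) := by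
  induction n with
  | zero =>
    intro s _
    simpa [sigLevel_zero] using ContinuousLinearMap.norm_id_le
  | succ n ih =>
    intro s hs
    have hℓ := fun t => (hasDerivAt_integral_lower hγ.norm b t).const_mul ‖A‖
    have h := norm_sub_le_sub_of_norm_deriv_le hs
      (fun t _ => hasDerivAt_sigLevel_succ A hγ b n t)
      (fun t _ => (hasDerivAt_pow_div_factorial (hℓ t) n).neg) (fun t ht => ?_)
    · simpa [sigLevel_succ_self] using h
    · rw [norm_neg]
      calc ‖(sigLevel A γ b n t).comp (A (deriv γ t))‖
          ≤ ‖sigLevel A γ b n t‖ * ‖A (deriv γ t)‖ := ContinuousLinearMap.opNorm_comp_le _ _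
        _ ≤ (‖A‖ * ∫ u in t..b, ‖deriv γ u‖) ^ n / (n.factorial : ℝ) *
            (‖A‖ * ‖deriv γ t‖) :=
          mul_le_mul (ih t ht.2) (A.le_opNorm _) (norm_nonneg _)
            ((norm_nonneg _).trans (ih t ht.2))
        _ = _ := by ring

/-- Telescoping: the truncated expansion, run along the solution, has as derivative its
last term. -/
theorem hasDerivAt_sum_sigLevel_apply (A : EuclideanSpace ℝ (Fin d) →L[ℝ] (F →L[ℝ] F))
    {γ : ℝ → EuclideanSpace ℝ (Fin d)} (hγ : Continuous (deriv γ)) {y : ℝ → F} {s : ℝ}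
    (hy : HasDerivAt y (A (deriv γ s) (y s)) s) (b : ℝ) (N : ℕ) :
    HasDerivAt (fun s => ∑ n ∈ Finset.range (N + 1), sigLevel A γ b n s (y s))
      (sigLevel A γ b N s (A (deriv γ s) (y s))) s := by
  induction N with
  | zero => simpa [sigLevel_zero] using hy
  | succ N ih =>
    simp_rw [Finset.sum_range_succ _ (N + 1)]
    refine (ih.add ((hasDerivAt_sigLevel_succ A hγ b N s).clm_apply hy)).congr_deriv ?_
    simp

end SigLevel

/-- The one-dimensional telescoping: the truncated exponential of `K - m`, times `exp m`. -/
theorem hasDerivAt_sum_pow_mul_exp {m : ℝ → ℝ} {m' s : ℝ} (hm : HasDerivAt m m' s)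
    (K : ℝ) (N : ℕ) :
    HasDerivAt (fun s => (∑ n ∈ Finset.range (N + 1), (m s) ^ n / (n.factorial : ℝ)) *
        Real.exp (K - m s))
      (m s ^ N / (N.factorial : ℝ) * (-m') * Real.exp (K - m s)) s := by
  have he := (hm.const_sub K).exp
  induction N with
  | zero => simpa [mul_comm] using he
  | succ N ih =>
    simp_rw [Finset.sum_range_succ _ (N + 1), add_mul]
    refine (ih.add ((hasDerivAt_pow_div_factorial hm N).mul he)).congr_deriv ?_
    ring

theorem tsum_pow_div_factorial_tail (x : ℝ) (N : ℕ) :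
    ∑' n : ℕ, x ^ (N + n) / ((N + n).factorial : ℝ) =
      Real.exp x - ∑ n ∈ Finset.range N, x ^ n / (n.factorial : ℝ) := by
  have h := (Real.summable_pow_div_factorial x).sum_add_tsum_nat_add N
  have he : Real.exp x = ∑' n : ℕ, x ^ n / (n.factorial : ℝ) := by
    rw [Real.exp_eq_exp_ℝ, NormedSpace.exp_eq_tsum_div]
  rw [he, ← h]
  simp [add_comm]

/-- Uniform error control for the truncated signature expansion of the solution of
a linear controlled differential equation: the `N`-th remainder is bounded by
`(Σ_{n ≥ N} ‖A‖ⁿ Lⁿ / n!) ‖y(a)‖` where `L` is the length of `γ`. -/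
theorem linear_CDE_truncation_error {d : ℕ} {F : Type*}
    [NormedAddCommGroup F] [NormedSpace ℝ F] [CompleteSpace F]
    (A : EuclideanSpace ℝ (Fin d) →L[ℝ] (F →L[ℝ] F))
    (γ : ℝ → EuclideanSpace ℝ (Fin d)) (a b : ℝ) (hab : a ≤ b)
    (hγ : ContDiff ℝ 1 γ) (y : ℝ → F)
    (hy : ∀ t ∈ Set.Icc a b, HasDerivAt y (A (deriv γ t) (y t)) t)
    (L : ℝ) (hL : L = ∫ u in a..b, ‖deriv γ u‖) (N : ℕ) :
    ‖y b - ∑ n ∈ Finset.range N, ∑ f : Fin n → Fin d,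
        sig γ (List.ofFn f) a b • wordOp (fun e => A e) (List.ofFn f) (y a)‖ ≤
      (∑' n : ℕ, ‖A‖ ^ (N + n) * L ^ (N + n) / (Nat.factorial (N + n) : ℝ)) * ‖y a‖ := by
  have hγ' : Continuous (deriv γ) := hγ.continuous_deriv le_rfl
  set ℓ : ℝ → ℝ := fun s => ‖A‖ * ∫ u in s..b, ‖deriv γ u‖ with hℓ_def
  have hℓ : ∀ t, HasDerivAt ℓ (‖A‖ * -‖deriv γ t‖) t := fun t =>
    (hasDerivAt_integral_lower hγ'.norm b t).const_mul ‖A‖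
  have hℓa : ℓ a = ‖A‖ * L := by rw [hL]
  have hℓb : ℓ b = 0 := by simp [hℓ_def]
  have hgron : ∀ t ∈ Icc a b, ‖y t‖ ≤ Real.exp (ℓ a - ℓ t) * ‖y a‖ := by
    intro t ht
    have h := norm_le_exp_mul_of_norm_deriv_le hy (fun t _ => (hℓ t).neg) (fun t _ => ?_) ht
    · simpa [neg_add_eq_sub] using h
    · simpa using (A (deriv γ t)).le_of_opNorm_le (A.le_opNorm _) (y t)
  have hsum : ∀ n, ∑ f : Fin n → Fin d,
      sig γ (List.ofFn f) a b • wordOp (fun e => A e) (List.ofFn f) (y a) =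
        sigLevel A γ b n a (y a) := fun n => by
    simp [sigLevel]
  simp_rw [hsum, ← mul_pow, ← hℓa]
  rw [tsum_pow_div_factorial_tail]
  cases N with
  | zero => simpa [hℓb] using hgron b (right_mem_Icc.2 hab)
  | succ N =>
    have h := norm_sub_le_sub_of_norm_deriv_le hab
      (fun t ht => hasDerivAt_sum_sigLevel_apply A hγ' (hy t ht) b N)
      (fun t _ => (hasDerivAt_sum_pow_mul_exp (hℓ t) (ℓ a) N).mul_const ‖y a‖)
      (fun t ht => ?_)
    · simpa [Finset.sum_range_succ', sigLevel_succ_self, sigLevel_zero, hℓb, sub_mul] using h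
    · calc ‖sigLevel A γ b N t (A (deriv γ t) (y t))‖
          ≤ ‖sigLevel A γ b N t‖ * (‖A‖ * ‖deriv γ t‖ * ‖y t‖) :=
            (sigLevel A γ b N t).le_opNorm_of_le
              ((A (deriv γ t)).le_of_opNorm_le (A.le_opNorm _) (y t))
        _ ≤ ℓ t ^ N / (N.factorial : ℝ) *
              (‖A‖ * ‖deriv γ t‖ * (Real.exp (ℓ a - ℓ t) * ‖y a‖)) := by
          have h1 := norm_sigLevel_le A hγ' b N t ht.2
          exact mul_le_mul h1 (mul_le_mul_of_nonneg_left (hgron t ht) (by positivity))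
            (by positivity) ((norm_nonneg _).trans h1)
        _ = _ := by ring
end

section
/- The signature is invariant under reparameterisation: let γ : [a,b] → ℝ^d be a C¹ path and let τ : [c,d] → [a,b] be a C¹, monotone increasing surjection. Then for every word w over {1,…,d}, S^w_{c,d}(γ∘τ) = S^w_{a,b}(γ). -/
open MeasureTheory intervalIntegral Set Filter

theorem continuous_deriv_coord {d : ℕ} {γ : ℝ → EuclideanSpace ℝ (Fin d)}
    (hγ : ContDiff ℝ 1 γ) (i : Fin d) : Continuous fun u => deriv γ u i := by
  have h : Continuous (deriv γ) := hγ.continuous_deriv le_rfl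
  fun_prop

/-- Signature coefficients depend continuously on the left endpoint. -/
theorem continuous_sig_left {d : ℕ} {γ : ℝ → EuclideanSpace ℝ (Fin d)}
    (hγ : ContDiff ℝ 1 γ) (w : List (Fin d)) (t : ℝ) :
    Continuous fun s => sig γ w s t := by
  induction w with
  | nil => simpa only [sig] using continuous_const
  | cons i w ih =>
    have h : Continuous fun u => deriv γ u i * sig γ w u t :=
      (continuous_deriv_coord hγ i).mul ih
    simp only [sig]
    simp_rw [integral_symm t]
    exact (continuous_primitive (fun a b => h.intervalIntegrable a b) t).neg

/-- Signature coefficients of a composition with a `C¹` change of parameter,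
which need not be monotone. -/
theorem sig_comp {d : ℕ} {γ : ℝ → EuclideanSpace ℝ (Fin d)} (hγ : ContDiff ℝ 1 γ)
    {τ : ℝ → ℝ} (hτ : ContDiff ℝ 1 τ) (w : List (Fin d)) (s t : ℝ) :
    sig (γ ∘ τ) w s t = sig γ w (τ s) (τ t) := by
  induction w generalizing s with
  | nil => simp only [sig]
  | cons i w ih =>
    have hτd : Differentiable ℝ τ := hτ.differentiable one_ne_zero
    have hγd : Differentiable ℝ γ := hγ.differentiable one_ne_zero
    have hsub := integral_comp_mul_deriv (a := s) (b := t) (f := τ) (f' := deriv τ)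
      (g := fun u => deriv γ u i * sig γ w u (τ t))
      (fun x _ => (hτd x).hasDerivAt) (hτ.continuous_deriv le_rfl).continuousOn
      ((continuous_deriv_coord hγ i).mul (continuous_sig_left hγ w (τ t)))
    simp only [sig]
    rw [← hsub]
    refine integral_congr fun u _ => ?_
    have hchain : deriv (γ ∘ τ) u = deriv τ u • deriv γ (τ u) :=
      ((hγd (τ u)).hasDerivAt.scomp u (hτd u).hasDerivAt).deriv
    simp only [ih, hchain, Function.comp_apply, PiLp.smul_apply, smul_eq_mul]
    ring

/-- The signature is invariant under reparameterisation: if `τ : [c,e] → [a,b]`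
is a C¹ monotone increasing surjection, then for every word `w`,
`S^w_{c,e}(γ∘τ) = S^w_{a,b}(γ)`. -/
theorem signature_reparam_invariant {d : ℕ}
    (γ : ℝ → EuclideanSpace ℝ (Fin d)) (a b c e : ℝ) (hab : a ≤ b) (hce : c ≤ e)
    (hγ : ContDiff ℝ 1 γ)
    (τ : ℝ → ℝ) (hτ : ContDiff ℝ 1 τ) (hmono : MonotoneOn τ (Set.Icc c e))
    (hsurj : τ '' Set.Icc c e = Set.Icc a b) :
    ∀ w : List (Fin d), sig (γ ∘ τ) w c e = sig γ w a b := by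
  intro w
  have hc : τ c = a :=
    (hmono.map_isLeast (isLeast_Icc hce)).unique (hsurj ▸ isLeast_Icc hab)
  have he : τ e = b :=
    (hmono.map_isGreatest (isGreatest_Icc hce)).unique (hsurj ▸ isGreatest_Icc hab)
  rw [sig_comp hγ hτ, hc, he]
end

section
/- (Chow–Rashevskii surjectivity onto truncated grouplike elements.) Let d ≥ 1, N ≥ 0, and let x be a real-valued function on the words of length at most N over the alphabet {1,…,d} with x(∅) = 1 which satisfies the truncated shuffle relations: for all words u, v with |u| + |v| ≤ N, x(u)·x(v) = Σ_s x(w(s)), the sum over all shuffles w(s) of u and v. Then there exists a C¹ path γ : [0,1] → ℝ^d such that S^w_{0,1}(γ) = x(w) for every word w of length at most N. That is, the map from paths to the free nilpotent group of step N (the level-N truncated signature) is onto. -/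
open MeasureTheory intervalIntegral Set Filter

/-- Given words `u, v` and a subset `s` of the positions `{0,…,m+n-1}` (where
`m = |u|`, `n = |v|`), the interleaved word placing the letters of `u` in order
at the positions of `s` and the letters of `v` in order at the remaining
positions. -/
def shuffleWord {α : Type*} (u v : List α) (s : Finset (Fin (u.length + v.length))) :
    List α :=
  (List.finRange (u.length + v.length)).filterMap fun p =>
    if p ∈ s then u[(s.filter (fun q => q < p)).card]?
    else v[((sᶜ : Finset (Fin (u.length + v.length))).filter (fun q => q < p)).card]?

/-- Noncommutative formal power series over the alphabet `α`, as functions on words. -/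
def WordSeries (α : Type*) := List α → ℝ

namespace WordSeries

variable {α : Type*}

noncomputable instance : AddCommGroup (WordSeries α) := inferInstanceAs (AddCommGroup (List α → ℝ))

noncomputable instance : Module ℝ (WordSeries α) := inferInstanceAs (Module ℝ (List α → ℝ))

@[simp] lemma add_apply (a b : WordSeries α) (w : List α) : (a + b) w = a w + b w := rfl

@[simp] lemma sub_apply (a b : WordSeries α) (w : List α) : (a - b) w = a w - b w := rfl

@[simp] lemma zero_apply (w : List α) : (0 : WordSeries α) w = 0 := rfl

@[simp] lemma smul_apply (c : ℝ) (a : WordSeries α) (w : List α) : (c • a) w = c * a w := rfl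

@[ext] lemma ext {a b : WordSeries α} (h : ∀ w, a w = b w) : a = b := funext h

/-- The series `w ↦ a (i w)`. -/
def shift (i : α) (a : WordSeries α) : WordSeries α := fun w => a (i :: w)

/-- The series `w ↦ a (w i)`. -/
def shiftRight (i : α) (a : WordSeries α) : WordSeries α := fun w => a (w ++ [i])

/-- The concatenation (Cauchy) product. -/
noncomputable def conv : WordSeries α → WordSeries α → List α → ℝ
  | a, b, [] => a [] * b []
  | a, b, i :: w => a [] * b (i :: w) + conv (shift i a) b w

noncomputable instance : Mul (WordSeries α) := ⟨fun a b => conv a b⟩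

noncomputable instance : One (WordSeries α) :=
  ⟨fun w => match w with
    | [] => 1
    | _ :: _ => 0⟩

@[simp] lemma one_nil : (1 : WordSeries α) [] = 1 := rfl

@[simp] lemma one_cons (i : α) (w : List α) : (1 : WordSeries α) (i :: w) = 0 := rfl

@[simp] lemma mul_nil (a b : WordSeries α) : (a * b) [] = a [] * b [] := rfl

lemma mul_cons (a b : WordSeries α) (i : α) (w : List α) :
    (a * b) (i :: w) = a [] * b (i :: w) + (shift i a * b) w := rfl

@[simp] lemma shift_add (i : α) (a b : WordSeries α) : shift i (a + b) = shift i a + shift i b := rfl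

@[simp] lemma shift_smul (i : α) (c : ℝ) (a : WordSeries α) : shift i (c • a) = c • shift i a := rfl

@[simp] lemma shift_one (i : α) : shift i (1 : WordSeries α) = 0 := rfl

@[simp] lemma shift_zero (i : α) : shift i (0 : WordSeries α) = 0 := rfl

lemma shift_mul (i : α) (a b : WordSeries α) :
    shift i (a * b) = a [] • shift i b + shift i a * b := rfl

protected lemma add_mul (a b c : WordSeries α) : (a + b) * c = a * c + b * c := by
  ext w
  induction w generalizing a b with
  | nil => simp [_root_.add_mul]
  | cons i w ih => simp only [mul_cons, add_apply, shift_add, ih]; ring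

protected lemma mul_add (a b c : WordSeries α) : a * (b + c) = a * b + a * c := by
  ext w
  induction w generalizing a with
  | nil => simp [_root_.mul_add]
  | cons i w ih => simp only [mul_cons, add_apply, ih]; ring

protected lemma smul_mul (r : ℝ) (a b : WordSeries α) : (r • a) * b = r • (a * b) := by
  ext w
  induction w generalizing a with
  | nil => simp [mul_assoc]
  | cons i w ih => simp only [mul_cons, smul_apply, shift_smul, ih]; ring

protected lemma zero_mul (a : WordSeries α) : 0 * a = 0 := by
  ext w
  induction w with
  | nil => simp
  | cons i w ih => simp [mul_cons, ih]

protected lemma mul_zero (a : WordSeries α) : a * 0 = 0 := by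
  ext w
  induction w generalizing a with
  | nil => simp
  | cons i w ih => simp [mul_cons, ih]

protected lemma one_mul (a : WordSeries α) : 1 * a = a := by
  ext w
  cases w with
  | nil => simp
  | cons i w => simp [mul_cons, WordSeries.zero_mul]

protected lemma mul_one (a : WordSeries α) : a * 1 = a := by
  ext w
  induction w generalizing a with
  | nil => simp
  | cons i w ih => simp [mul_cons, ih, shift]

protected lemma mul_assoc (a b c : WordSeries α) : a * b * c = a * (b * c) := by
  ext w
  induction w generalizing a with
  | nil => simp [_root_.mul_assoc]
  | cons i w ih =>
    simp only [mul_cons, shift_mul, WordSeries.add_mul, WordSeries.smul_mul, add_apply, smul_apply,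
      mul_nil, ih]
    ring

noncomputable instance : Ring (WordSeries α) :=
  { (inferInstance : AddCommGroup (WordSeries α)) with
    left_distrib := WordSeries.mul_add
    right_distrib := WordSeries.add_mul
    zero_mul := WordSeries.zero_mul
    mul_zero := WordSeries.mul_zero
    mul_assoc := WordSeries.mul_assoc
    one_mul := WordSeries.one_mul
    mul_one := WordSeries.mul_one }

/-- All coefficients of degree less than `k` vanish. -/
def VanishesBelow (k : ℕ) (a : WordSeries α) : Prop := ∀ w : List α, w.length < k → a w = 0

lemma VanishesBelow.mul {k l : ℕ} {a b : WordSeries α} (ha : VanishesBelow k a)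
    (hb : VanishesBelow l b) : VanishesBelow (k + l) (a * b) := by
  intro w hw
  induction w generalizing a k with
  | nil =>
    rw [mul_nil]
    rcases Nat.eq_zero_or_pos k with rfl | hk
    · rw [hb [] (by simpa using hw), mul_zero]
    · rw [ha [] hk, zero_mul]
  | cons i w ih =>
    rw [List.length_cons] at hw
    rw [mul_cons]
    cases k with
    | zero =>
      rw [hb _ (by simpa using hw), ih (k := 0) (fun _ h => absurd h (by simp)) (by omega)]
      simp
    | succ k =>
      rw [ha [] (by simp), ih (k := k) (a := shift i a) (fun v hv => ha _ (by simpa using hv)) (by omega)]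
      simp

lemma VanishesBelow.mul_apply {k l : ℕ} {a b : WordSeries α} (ha : VanishesBelow k a)
    (hb : VanishesBelow l b) {w : List α} (hw : w.length = k + l) :
    (a * b) w = a (w.take k) * b (w.drop k) := by
  induction w generalizing a k with
  | nil => simp
  | cons i w ih =>
    rw [List.length_cons] at hw
    rw [mul_cons]
    cases k with
    | zero =>
      rw [VanishesBelow.mul (k := 0) (fun _ h => absurd h (by simp)) hb _ (by omega)]
      simp
    | succ k =>
      rw [ha [] (by simp), ih (k := k) (a := shift i a) (fun v hv => ha _ (by simpa using hv)) (by omega)]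
      simp [shift]

/-- The sum of `x` over all shuffles of two words. -/
noncomputable def shuffleSum : WordSeries α → List α → List α → ℝ
  | x, [], v => x v
  | x, a :: u, [] => x (a :: u)
  | x, a :: u, b :: v => shuffleSum (shift a x) u (b :: v) + shuffleSum (shift b x) (a :: u) v
termination_by _ u v => u.length + v.length

@[simp] lemma shuffleSum_nil_left (x : WordSeries α) (v : List α) : shuffleSum x [] v = x v := by
  rw [shuffleSum]

@[simp] lemma shuffleSum_nil_right (x : WordSeries α) (u : List α) : shuffleSum x u [] = x u := by
  cases u <;> rw [shuffleSum]

lemma shuffleSum_cons_cons (x : WordSeries α) (a b : α) (u v : List α) :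
    shuffleSum x (a :: u) (b :: v) =
      shuffleSum (shift a x) u (b :: v) + shuffleSum (shift b x) (a :: u) v := by
  rw [shuffleSum]

/-- Induction along the recursion of `shuffleSum`. -/
lemma shuffle_induction {P : List α → List α → Prop} (nil_left : ∀ v, P [] v)
    (nil_right : ∀ u, P u []) (cons_cons : ∀ a u b v, P u (b :: v) → P (a :: u) v →
      P (a :: u) (b :: v)) (u v : List α) : P u v := by
  induction u generalizing v with
  | nil => exact nil_left v
  | cons a u ihu =>
    induction v with
    | nil => exact nil_right _
    | cons b v ihv => exact cons_cons _ _ _ _ (ihu _) ihv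

lemma shuffleSum_smul_sub (c : ℝ) (x y : WordSeries α) (u v : List α) :
    shuffleSum (c • (x - y)) u v = c * (shuffleSum x u v - shuffleSum y u v) := by
  induction u, v using shuffle_induction generalizing x y with
  | nil_left v => simp
  | nil_right u => simp
  | cons_cons a u b v h₁ h₂ =>
    have hs : ∀ i, shift i (c • (x - y)) = c • (shift i x - shift i y) := fun i => rfl
    simp only [shuffleSum_cons_cons, hs, h₁, h₂]
    ring

lemma shuffleSum_concat_concat (x : WordSeries α) (a b : α) (u v : List α) :
    shuffleSum x (u ++ [a]) (v ++ [b]) =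
      shuffleSum (shiftRight a x) u (v ++ [b]) + shuffleSum (shiftRight b x) (u ++ [a]) v := by
  have hc : ∀ i j (x : WordSeries α), shift i (shiftRight j x) = shiftRight j (shift i x) :=
    fun _ _ _ => rfl
  have h₁ : ∀ (v : List α) (x : WordSeries α), shuffleSum x [a] (v ++ [b]) =
      shuffleSum (shiftRight a x) [] (v ++ [b]) + shuffleSum (shiftRight b x) [a] v := by
    intro v
    induction v with
    | nil => intro x; simp [shuffleSum_cons_cons, shift, shiftRight, add_comm]
    | cons d v ih =>
      intro x
      rw [List.cons_append, shuffleSum_cons_cons, ih, shuffleSum_cons_cons]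
      simp [shift, shiftRight, hc]
      ring
  have h₂ : ∀ (u : List α) (x : WordSeries α), shuffleSum x (u ++ [a]) [b] =
      shuffleSum (shiftRight a x) u [b] + shuffleSum (shiftRight b x) (u ++ [a]) [] := by
    intro u
    induction u with
    | nil => intro x; simp [shuffleSum_cons_cons, shift, shiftRight, add_comm]
    | cons d u ih =>
      intro x
      rw [List.cons_append, shuffleSum_cons_cons, ih, shuffleSum_cons_cons]
      simp [shift, shiftRight, hc]
      ring
  induction u, v using shuffle_induction generalizing x with
  | nil_left v => exact h₁ v x
  | nil_right u => exact h₂ u x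
  | cons_cons c u d v ih₁ ih₂ =>
    simp only [List.cons_append, shuffleSum_cons_cons, hc] at ih₁ ih₂ ⊢
    rw [ih₁, ih₂]
    ring

/-- Sum over all choices of a centre letter in `q`, for a word whose letters to the left of `q`
are those of `p` read backwards, of the signed shuffles of the letters on either side. -/
noncomputable def centreSum : WordSeries α → List α → List α → ℝ
  | _, _, [] => 0
  | x, p, a :: q => (-1) ^ p.length * shuffleSum (shift a x) p q + centreSum x (a :: p) q

/-- The transposed Dynkin operator, applied to the functional `x`. -/
noncomputable def dynkin (x : WordSeries α) : WordSeries α := fun w => centreSum x [] w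

lemma centreSum_concat (x : WordSeries α) (p q : List α) (a b : α) :
    centreSum x (p ++ [a]) (q ++ [b]) =
      centreSum (shiftRight b x) (p ++ [a]) q - centreSum (shiftRight a x) p (q ++ [b]) := by
  have hc : ∀ i j (x : WordSeries α), shift i (shiftRight j x) = shiftRight j (shift i x) :=
    fun _ _ _ => rfl
  induction q generalizing p with
  | nil => simp [centreSum, shift, shiftRight, pow_succ]
  | cons c q ih =>
    have := ih (c :: p)
    simp only [List.cons_append] at this
    simp only [List.cons_append, centreSum, this, shuffleSum_concat_concat, hc, List.length_append,
      List.length_singleton, pow_succ]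
    ring

lemma dynkin_cons_concat (x : WordSeries α) (q : List α) (a b : α) :
    dynkin x (a :: (q ++ [b])) =
      dynkin (shiftRight b x) (a :: q) - dynkin (shiftRight a x) (q ++ [b]) := by
  have := centreSum_concat x [] q a b
  simp only [List.nil_append] at this
  simp only [dynkin, centreSum, this, shuffleSum_nil_left, shift, shiftRight, List.cons_append]
  ring

/-- A functional which vanishes on proper shuffles is, up to a factor, in the image of the
Dynkin operator. -/
lemma dynkin_eq_length_mul {x : WordSeries α} {w : List α}
    (h : ∀ u v : List α, u ≠ [] → v ≠ [] → u.length + v.length = w.length → shuffleSum x u v = 0) :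
    dynkin x w = w.length * x w := by
  have key : ∀ (q p : List α) (a : α), (a :: p).length + q.length = w.length →
      centreSum x (a :: p) q + (-1) ^ (p.length + 1) * q.length * shuffleSum (shift a x) p q = 0 := by
    intro q
    induction q with
    | nil => intro p a _; simp [centreSum]
    | cons b q ih =>
      intro p a hl
      have h₀ := h (a :: p) (b :: q) (by simp) (by simp) hl
      have h₁ := ih (a :: p) b (by simp at hl ⊢; omega)
      rw [shuffleSum_cons_cons] at h₀
      simp only [centreSum, List.length_cons, pow_succ, Nat.cast_add, Nat.cast_one] at h₁ ⊢
      linear_combination h₁ - (-1) ^ p.length * (q.length + 1) * h₀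
  cases w with
  | nil => simp [dynkin, centreSum]
  | cons a w =>
    have := key w [] a (by simp; omega)
    simp only [List.length_nil, shuffleSum_nil_left, shift] at this
    simp only [dynkin, centreSum, List.length_nil, shuffleSum_nil_left, shift, List.length_cons,
      Nat.cast_add, Nat.cast_one]
    linear_combination this

lemma sum_apply {ι : Type*} (s : Finset ι) (f : ι → WordSeries α) (w : List α) :
    (∑ i ∈ s, f i) w = ∑ i ∈ s, f i w :=
  Finset.sum_apply w s (fun i => (f i : List α → ℝ))

end WordSeries

section Signature

open WordSeries

variable {d : ℕ}

/-- The signature of a path over `[s, t]`, as a series. -/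
noncomputable def sigSeries (γ : ℝ → EuclideanSpace ℝ (Fin d)) (s t : ℝ) : WordSeries (Fin d) :=
  fun w => sig γ w s t

lemma eq_of_hasDerivAt_of_eq {f g f' : ℝ → ℝ} (hf : ∀ s, HasDerivAt f (f' s) s)
    (hg : ∀ s, HasDerivAt g (f' s) s) {r : ℝ} (h : f r = g r) (s : ℝ) : f s = g s := by
  have := is_const_of_deriv_eq_zero (f := fun s => f s - g s)
    (fun s => ((hf s).sub (hg s)).differentiableAt)
    (fun s => ((hf s).sub (hg s)).deriv.trans (sub_self _)) s r
  simp only [h, sub_self] at this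
  linarith

/-- The derivative of the signature in its initial time. -/
noncomputable def sigDeriv (γ : ℝ → EuclideanSpace ℝ (Fin d)) (s t : ℝ) : WordSeries (Fin d)
  | [] => 0
  | i :: w => -(deriv γ s i * sig γ w s t)

lemma continuous_deriv_apply {γ : ℝ → EuclideanSpace ℝ (Fin d)} (hγ : ContDiff ℝ 1 γ) (i : Fin d) :
    Continuous fun s => deriv γ s i := by
  have := hγ.continuous_deriv le_rfl
  fun_prop

lemma hasDerivAt_sigSeries {γ : ℝ → EuclideanSpace ℝ (Fin d)} (hγ : ContDiff ℝ 1 γ)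
    (w : List (Fin d)) (s t : ℝ) :
    HasDerivAt (fun s => sigSeries γ s t w) (sigDeriv γ s t w) s := by
  induction w generalizing s with
  | nil => exact hasDerivAt_const s 1
  | cons i w ih =>
    have hc : Continuous fun u => deriv γ u i * sig γ w u t :=
      (continuous_deriv_apply hγ i).mul
        (continuous_iff_continuousAt.2 fun s => (ih s).continuousAt)
    exact integral_hasDerivAt_left (hc.intervalIntegrable _ _)
      hc.aestronglyMeasurable.stronglyMeasurableAtFilter hc.continuousAt

lemma sigSeries_self (γ : ℝ → EuclideanSpace ℝ (Fin d)) (t : ℝ) : sigSeries γ t t = 1 := by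
  ext w
  cases w <;> simp [sigSeries, sig]

lemma hasDerivAt_series_mul_const {A A' : ℝ → WordSeries (Fin d)} {s : ℝ}
    (hA : ∀ w, HasDerivAt (fun s => A s w) (A' s w) s) (b : WordSeries (Fin d))
    (w : List (Fin d)) : HasDerivAt (fun s => (A s * b) w) ((A' s * b) w) s := by
  induction w generalizing A A' with
  | nil => exact (hA []).mul_const _
  | cons i w ih =>
    exact ((hA []).mul_const _).add
      (ih (A := fun s => shift i (A s)) (A' := fun s => shift i (A' s)) fun w => hA (i :: w))

/-- Chen's identity. -/
lemma sigSeries_mul {γ : ℝ → EuclideanSpace ℝ (Fin d)} (hγ : ContDiff ℝ 1 γ) (s r t : ℝ) :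
    sigSeries γ s r * sigSeries γ r t = sigSeries γ s t := by
  ext w
  induction w generalizing s with
  | nil => simp [sigSeries, sig]
  | cons i w ih =>
    refine eq_of_hasDerivAt_of_eq (f := fun s => (sigSeries γ s r * sigSeries γ r t) (i :: w))
      (g := fun s => sigSeries γ s t (i :: w)) (r := r) (fun s => ?_)
      (fun s => hasDerivAt_sigSeries hγ (i :: w) s t) (by simp [sigSeries_self]) s
    convert hasDerivAt_series_mul_const (A := fun s => sigSeries γ s r) (A' := fun s => sigDeriv γ s r)
      (fun w => hasDerivAt_sigSeries hγ w s r) (sigSeries γ r t) (i :: w) using 1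
    have hs : shift i (sigDeriv γ s r) = (-deriv γ s i) • sigSeries γ s r := by
      ext v
      simp [shift, sigDeriv, sigSeries]
    rw [mul_cons, hs, WordSeries.smul_mul, smul_apply, ih]
    simp [sigDeriv, sigSeries]

lemma hasDerivAt_shuffleSum {A A' : ℝ → WordSeries (Fin d)} {s : ℝ}
    (hA : ∀ w, HasDerivAt (fun s => A s w) (A' s w) s) (u v : List (Fin d)) :
    HasDerivAt (fun s => shuffleSum (A s) u v) (shuffleSum (A' s) u v) s := by
  induction u, v using shuffle_induction generalizing A A' with
  | nil_left v => simpa using hA v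
  | nil_right u => simpa using hA u
  | cons_cons a u b v h₁ h₂ =>
    simp only [shuffleSum_cons_cons]
    exact (h₁ (A := fun s => shift a (A s)) (A' := fun s => shift a (A' s)) fun w => hA _).add
      (h₂ (A := fun s => shift b (A s)) (A' := fun s => shift b (A' s)) fun w => hA _)

lemma shuffleSum_smul (c : ℝ) (x : WordSeries (Fin d)) (u v : List (Fin d)) :
    shuffleSum (c • x) u v = c * shuffleSum x u v := by
  induction u, v using shuffle_induction generalizing x with
  | nil_left v => simp
  | nil_right u => simp
  | cons_cons a u b v h₁ h₂ => simp only [shuffleSum_cons_cons, shift_smul, h₁, h₂, mul_add]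

/-- The shuffle identity for signatures. -/
lemma shuffleSum_sigSeries {γ : ℝ → EuclideanSpace ℝ (Fin d)} (hγ : ContDiff ℝ 1 γ)
    (u v : List (Fin d)) (s t : ℝ) :
    shuffleSum (sigSeries γ s t) u v = sig γ u s t * sig γ v s t := by
  induction u, v using shuffle_induction generalizing s with
  | nil_left v => simp [sigSeries, sig]
  | nil_right u => simp [sigSeries, sig]
  | cons_cons a u b v h₁ h₂ =>
    have hs : ∀ s i, shift i (sigDeriv γ s t) = (-deriv γ s i) • sigSeries γ s t := by
      intro s i
      ext v
      simp [shift, sigDeriv, sigSeries]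
    refine eq_of_hasDerivAt_of_eq (r := t)
      (f := fun s => shuffleSum (sigSeries γ s t) (a :: u) (b :: v))
      (g := fun s => sig γ (a :: u) s t * sig γ (b :: v) s t)
      (fun s => hasDerivAt_shuffleSum (A := fun s => sigSeries γ s t)
        (A' := fun s => sigDeriv γ s t) (fun w => hasDerivAt_sigSeries hγ w s t) _ _)
      (fun s => ?_) ?_ s
    · refine ((hasDerivAt_sigSeries hγ (a :: u) s t).mul
        (hasDerivAt_sigSeries hγ (b :: v) s t)).congr_deriv ?_
      rw [shuffleSum_cons_cons, hs, hs, shuffleSum_smul, shuffleSum_smul, h₁, h₂]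
      simp only [sigDeriv, sigSeries]
      ring
    · have h0 : ∀ u v, shuffleSum (0 : WordSeries (Fin d)) u v = 0 := fun u v => by
        simpa using shuffleSum_smul (0 : ℝ) 0 u v
      simp [sigSeries_self, shuffleSum_cons_cons, h0, sig]

lemma sig_congr {γ η : ℝ → EuclideanSpace ℝ (Fin d)} {s t : ℝ} (hst : s ≤ t)
    (h : ∀ u ∈ Icc s t, deriv γ u = deriv η u) (w : List (Fin d)) :
    sig γ w s t = sig η w s t := by
  induction w generalizing s with
  | nil => rfl
  | cons i w ih =>
    refine integral_congr fun u hu => ?_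
    rw [uIcc_of_le hst] at hu
    simp only [h u hu, ih hu.2 fun v hv => h v ⟨hu.1.trans hv.1, hv.2⟩]

lemma single_eq_smul (i : Fin d) (c : ℝ) :
    EuclideanSpace.single i c = c • EuclideanSpace.single i (1 : ℝ) := by
  ext j
  simp [PiLp.single_apply]

/-- The exponential of the multiple `c` of the letter `i`. -/
noncomputable def expLetter (i : Fin d) (c : ℝ) : WordSeries (Fin d) := fun w =>
  if ∀ j ∈ w, j = i then c ^ w.length / w.length.factorial else 0

lemma sig_of_deriv_single {γ : ℝ → EuclideanSpace ℝ (Fin d)} {i : Fin d} {f F : ℝ → ℝ}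
    (hγ : ∀ t, deriv γ t = EuclideanSpace.single i (f t)) (hf : Continuous f)
    (hF : ∀ t, HasDerivAt F (f t) t) (s t : ℝ) : sigSeries γ s t = expLetter i (F t - F s) := by
  ext w
  induction w generalizing s with
  | nil => simp [sigSeries, sig, expLetter]
  | cons j w ih =>
    have hFc : Continuous F := continuous_iff_continuousAt.2 fun t => (hF t).continuousAt
    have hu : ∀ u, sig γ w u t = expLetter i (F t - F u) w := ih
    simp only [sigSeries, sig, hγ, hu]
    by_cases hj : j = i
    · subst hj
      by_cases hw : ∀ k ∈ w, k = j
      · simp only [expLetter, List.mem_cons, forall_eq_or_imp, true_and, if_pos hw,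
          PiLp.single_apply, if_true, List.length_cons]
        have hd : ∀ u ∈ uIcc s t, HasDerivAt
            (fun u => -((F t - F u) ^ (w.length + 1) / ((w.length + 1).factorial : ℝ)))
            (f u * ((F t - F u) ^ w.length / (w.length.factorial : ℝ))) u := by
          intro u _
          refine ((((hF u).const_sub (F t)).pow (w.length + 1)).div_const
            ((w.length + 1).factorial : ℝ)).neg.congr_deriv ?_
          rw [Nat.factorial_succ]
          push_cast
          field_simp
        rw [integral_eq_sub_of_hasDerivAt hd (Continuous.intervalIntegrable (by fun_prop) _ _)]
        simp
      · simp [expLetter, hw]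
    · simp [expLetter, hj]

lemma expLetter_mul_neg (i : Fin d) (c : ℝ) : expLetter i c * expLetter i (-c) = 1 := by
  have hd : ∀ t, HasDerivAt (fun t : ℝ => EuclideanSpace.single i t)
      (EuclideanSpace.single i (1 : ℝ)) t := by
    intro t
    simpa only [← single_eq_smul, id] using
      (hasDerivAt_id t).smul_const (EuclideanSpace.single i (1 : ℝ))
  have hs := sig_of_deriv_single (γ := fun t : ℝ => EuclideanSpace.single i t) (f := fun _ => 1)
    (F := id) (fun t => (hd t).deriv) continuous_const hasDerivAt_id
  have hγ : ContDiff ℝ 1 (fun t : ℝ => EuclideanSpace.single i t) := by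
    have : ContDiff ℝ 1 (fun t : ℝ => t • EuclideanSpace.single i (1 : ℝ)) := by fun_prop
    simpa only [← single_eq_smul] using this
  have := sigSeries_mul hγ 0 c 0
  rw [hs, hs, sigSeries_self] at this
  simpa using this

/-- Finite products of exponentials of letters. -/
inductive IsExpProduct : WordSeries (Fin d) → Prop
  | one : IsExpProduct 1
  | exp (i : Fin d) (c : ℝ) : IsExpProduct (expLetter i c)
  | mul {g h : WordSeries (Fin d)} : IsExpProduct g → IsExpProduct h → IsExpProduct (g * h)

namespace IsExpProduct

lemma apply_nil {g : WordSeries (Fin d)} (hg : IsExpProduct g) : g [] = 1 := by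
  induction hg with
  | one => simp
  | exp i c => simp [expLetter]
  | mul _ _ h₁ h₂ => simp [h₁, h₂]

lemma exists_inverse {g : WordSeries (Fin d)} (hg : IsExpProduct g) :
    ∃ h, IsExpProduct h ∧ g * h = 1 ∧ h * g = 1 := by
  induction hg with
  | one => exact ⟨1, one, mul_one 1, mul_one 1⟩
  | exp i c =>
    exact ⟨_, exp i (-c), expLetter_mul_neg i c, by simpa using expLetter_mul_neg i (-c)⟩
  | @mul g₁ g₂ _ _ ih₁ ih₂ =>
    obtain ⟨h₁, hh₁, e₁, e₁'⟩ := ih₁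
    obtain ⟨h₂, hh₂, e₂, e₂'⟩ := ih₂
    refine ⟨h₂ * h₁, hh₂.mul hh₁, ?_, ?_⟩
    · rw [mul_assoc, ← mul_assoc g₂, e₂, one_mul, e₁]
    · rw [mul_assoc, ← mul_assoc h₁, e₁', one_mul, e₂']

/-- Every product of exponentials of letters is the signature of a path which moves only
during a prescribed interval. -/
lemma exists_path {g : WordSeries (Fin d)} (hg : IsExpProduct g) {a b : ℝ} (hab : a < b) :
    ∃ γ : ℝ → EuclideanSpace ℝ (Fin d), ContDiff ℝ 1 γ ∧ (∀ t ≤ a, deriv γ t = 0) ∧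
      (∀ t, b ≤ t → deriv γ t = 0) ∧ sigSeries γ a b = g := by
  induction hg generalizing a b with
  | one =>
    refine ⟨fun _ => 0, contDiff_const, by simp, by simp, ?_⟩
    ext w
    cases w <;> simp [sigSeries, sig]
  | exp i c =>
    set φ : ℝ → ℝ := fun t => max 0 ((t - a) * (b - t)) with hφ
    have hφc : Continuous φ := by fun_prop
    have hK : 0 < ∫ t in a..b, φ t := by
      refine intervalIntegral_pos_of_pos_on (hφc.intervalIntegrable _ _) (fun t ht => ?_) hab
      exact lt_max_of_lt_right (mul_pos (sub_pos.2 ht.1) (sub_pos.2 ht.2))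
    set K := ∫ t in a..b, φ t with hKdef
    set f : ℝ → ℝ := fun t => c / K * φ t with hf
    have hfc : Continuous f := by fun_prop
    have hF : ∀ t, HasDerivAt (fun t => ∫ u in a..t, f u) (f t) t := fun t =>
      integral_hasDerivAt_right (hfc.intervalIntegrable _ _)
        hfc.aestronglyMeasurable.stronglyMeasurableAtFilter hfc.continuousAt
    have hd : ∀ t, HasDerivAt (fun t => EuclideanSpace.single i (∫ u in a..t, f u))
        (EuclideanSpace.single i (f t)) t := by
      intro t
      simpa only [← single_eq_smul] using
        (hF t).smul_const (EuclideanSpace.single i (1 : ℝ))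
    refine ⟨fun t => EuclideanSpace.single i (∫ u in a..t, f u), ?_, fun t ht => ?_,
      fun t ht => ?_, ?_⟩
    · rw [contDiff_one_iff_deriv]
      refine ⟨fun t => (hd t).differentiableAt, ?_⟩
      rw [funext fun t => (hd t).deriv]
      have : Continuous fun t => f t • EuclideanSpace.single i (1 : ℝ) := by fun_prop
      simpa only [← single_eq_smul] using this
    · have : φ t = 0 := max_eq_left
        (mul_nonpos_of_nonpos_of_nonneg (by linarith) (by linarith))
      rw [(hd t).deriv]; simp [hf, this]
    · have : φ t = 0 := max_eq_left
        (mul_nonpos_of_nonneg_of_nonpos (by linarith) (by linarith))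
      rw [(hd t).deriv]; simp [hf, this]
    · rw [sig_of_deriv_single (fun t => (hd t).deriv) hfc hF]
      simp only [integral_same, sub_zero, hf, intervalIntegral.integral_const_mul, ← hKdef]
      rw [div_mul_cancel₀ _ hK.ne']
  | @mul g h _ _ ih₁ ih₂ =>
    obtain ⟨m, ham, hmb⟩ := exists_between hab
    obtain ⟨γ, hγ, hγa, hγm, rfl⟩ := ih₁ ham
    obtain ⟨η, hη, hηm, hηb, rfl⟩ := ih₂ hmb
    have hd : ∀ t, deriv (γ + η) t = deriv γ t + deriv η t := fun t =>
      deriv_add (hγ.differentiable one_ne_zero t) (hη.differentiable one_ne_zero t)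
    have hγη : ContDiff ℝ 1 (γ + η) := hγ.add hη
    refine ⟨γ + η, hγη, fun t ht => ?_, fun t ht => ?_, ?_⟩
    · rw [hd, hγa t ht, hηm t (by linarith), add_zero]
    · rw [hd, hγm t (by linarith), hηb t ht, add_zero]
    · rw [← sigSeries_mul hγη a m b]
      congr 1 <;> ext w
      · exact sig_congr ham.le (fun t ht => by rw [hd, hηm t ht.2, add_zero]) w
      · exact sig_congr hmb.le (fun t ht => by rw [hd, hγm t ht.1, zero_add]) w

lemma shuffleSum_eq {g : WordSeries (Fin d)} (hg : IsExpProduct g) (u v : List (Fin d)) :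
    shuffleSum g u v = g u * g v := by
  obtain ⟨γ, hγ, -, -, rfl⟩ := hg.exists_path zero_lt_one
  exact shuffleSum_sigSeries hγ u v 0 1

end IsExpProduct

/-- `m` is, in degree `n`, the leading term of a product of exponentials of letters. -/
def IsLeadingTerm (n : ℕ) (m : WordSeries (Fin d)) : Prop :=
  ∃ g, IsExpProduct g ∧ VanishesBelow n (g - 1) ∧ ∀ w : List (Fin d), w.length = n → g w = m w

lemma one_apply_of_length_pos {w : List (Fin d)} (hw : 0 < w.length) :
    (1 : WordSeries (Fin d)) w = 0 := by
  cases w with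
  | nil => simp at hw
  | cons i w => simp

lemma vanishesBelow_zero (a : WordSeries (Fin d)) : VanishesBelow 0 a :=
  fun _ h => absurd h (by simp)

lemma IsExpProduct.vanishesBelow_one {g : WordSeries (Fin d)} (hg : IsExpProduct g) :
    VanishesBelow 1 (g - 1) := by
  intro w hw
  obtain rfl := List.length_eq_zero_iff.1 (Nat.lt_one_iff.1 hw)
  simp [hg.apply_nil]

namespace IsLeadingTerm

lemma congr {n : ℕ} {m m' : WordSeries (Fin d)} (hm : IsLeadingTerm n m)
    (h : ∀ w : List (Fin d), w.length = n → m w = m' w) : IsLeadingTerm n m' := by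
  obtain ⟨g, hg, hv, hw⟩ := hm
  exact ⟨g, hg, hv, fun w hl => (hw w hl).trans (h w hl)⟩

lemma zero {n : ℕ} (hn : 0 < n) : IsLeadingTerm n (0 : WordSeries (Fin d)) :=
  ⟨1, .one, fun w _ => by simp, fun w hw => one_apply_of_length_pos (hw ▸ hn)⟩

lemma add {n : ℕ} (hn : 0 < n) {m m' : WordSeries (Fin d)} (hm : IsLeadingTerm n m)
    (hm' : IsLeadingTerm n m') : IsLeadingTerm n (m + m') := by
  obtain ⟨g, hg, hv, hw⟩ := hm
  obtain ⟨h, hh, hv', hw'⟩ := hm'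
  have e : g * h - 1 = (g - 1) + (h - 1) + (g - 1) * (h - 1) := by noncomm_ring
  have hp := hv.mul hv'
  refine ⟨g * h, hg.mul hh, fun w hl => ?_, fun w hl => ?_⟩
  · rw [e, add_apply, add_apply, hv w hl, hv' w hl, hp w (by omega)]
    simp
  · have h1 : (g * h - 1) w = g w + h w := by
      rw [e, add_apply, add_apply, hp w (by omega), sub_apply, sub_apply,
        one_apply_of_length_pos (by omega)]
      simp
    rw [sub_apply, one_apply_of_length_pos (by omega), sub_zero] at h1
    rw [h1, hw w hl, hw' w hl, add_apply]

lemma sum {ι : Type*} {n : ℕ} (hn : 0 < n) (s : Finset ι) {m : ι → WordSeries (Fin d)}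
    (hm : ∀ i ∈ s, IsLeadingTerm n (m i)) : IsLeadingTerm n (∑ i ∈ s, m i) :=
  Finset.sum_induction m (IsLeadingTerm n) (fun _ _ => add hn) (zero hn) hm

lemma letter (i : Fin d) (c : ℝ) :
    IsLeadingTerm 1 (fun w : List (Fin d) => if w = [i] then c else 0) := by
  refine ⟨expLetter i c, .exp i c, (IsExpProduct.exp i c).vanishesBelow_one, fun w hw => ?_⟩
  obtain ⟨j, rfl⟩ := List.length_eq_one_iff.1 hw
  simp [expLetter]

/-- Leading terms are stable under the bracket with a letter. -/
lemma bracket {n : ℕ} {m : WordSeries (Fin d)} (hm : IsLeadingTerm n m) (i : Fin d) :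
    IsLeadingTerm (n + 1) (fun w : List (Fin d) =>
      (if w.drop n = [i] then m (w.take n) else 0) -
        (if w.take 1 = [i] then m (w.drop 1) else 0)) := by
  rcases Nat.eq_zero_or_pos n with rfl | hn
  · refine (zero one_pos).congr fun w hw => ?_
    obtain ⟨j, rfl⟩ := List.length_eq_one_iff.1 hw
    simp
  obtain ⟨g, hg, hv, hw⟩ := hm
  set h := expLetter i (1 : ℝ)
  have hh : IsExpProduct h := .exp i 1
  obtain ⟨g', hg', e₁, -⟩ := hg.exists_inverse
  obtain ⟨h', hh', e₂, -⟩ := hh.exists_inverse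
  set c := (g - 1) * (h - 1) - (h - 1) * (g - 1) with hc
  have hcv : VanishesBelow (n + 1) c := fun w hl => by
    rw [hc, sub_apply, hv.mul hh.vanishesBelow_one w hl,
      hh.vanishesBelow_one.mul hv w (by omega), sub_zero]
  have e : g * h * (g' * h') - 1 = c * (g' * h') := by
    have h1 : h * g * (g' * h') = 1 := by
      rw [mul_assoc, ← mul_assoc g, e₁, one_mul, e₂]
    have h2 : c = g * h - h * g := by rw [hc]; noncomm_ring
    rw [h2, sub_mul, h1]
  have hone : ∀ w : List (Fin d), w.length = 1 → (h - 1) w = if w = [i] then 1 else 0 := by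
    intro w hl
    obtain ⟨j, rfl⟩ := List.length_eq_one_iff.1 hl
    simp [h, expLetter]
  have hgm : ∀ w : List (Fin d), w.length = n → (g - 1) w = m w := fun w hl => by
    rw [sub_apply, one_apply_of_length_pos (by omega), sub_zero, hw w hl]
  refine ⟨g * h * (g' * h'), (hg.mul hh).mul (hg'.mul hh'), fun w hl => ?_, fun w hl => ?_⟩
  · rw [e]
    exact hcv.mul (vanishesBelow_zero _) w hl
  · have h1 : (g * h * (g' * h') - 1) w = c w := by
      rw [e, hcv.mul_apply (vanishesBelow_zero _) hl, List.take_of_length_le hl.le,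
        List.drop_of_length_le hl.le, (hg'.mul hh').apply_nil, mul_one]
    rw [sub_apply, one_apply_of_length_pos (by omega), sub_zero] at h1
    rw [h1, hc, sub_apply, hv.mul_apply hh.vanishesBelow_one hl,
      hh.vanishesBelow_one.mul_apply hv (hl.trans (add_comm _ _)),
      hone _ (by simp [hl]), hone _ (by simp [hl]), hgm _ (by simp [hl]), hgm _ (by simp [hl])]
    simp

/-- The image of the Dynkin operator consists of leading terms. -/
lemma dynkin (n : ℕ) (x : WordSeries (Fin d)) : IsLeadingTerm (n + 1) (dynkin x) := by
  induction n generalizing x with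
  | zero =>
    refine (sum one_pos Finset.univ fun i _ => letter i (x [i])).congr fun w hw => ?_
    obtain ⟨j, rfl⟩ := List.length_eq_one_iff.1 hw
    refine (WordSeries.sum_apply _ _ _).trans ?_
    simp [WordSeries.dynkin, centreSum, shift]
  | succ n ih =>
    refine (sum (Nat.succ_pos _) Finset.univ fun i _ =>
      (ih (shiftRight i x)).bracket i).congr fun w hw => ?_
    obtain ⟨a, v, rfl⟩ := List.exists_cons_of_length_eq_add_one hw
    obtain ⟨q, b, rfl⟩ := (List.eq_nil_or_concat' v).resolve_left (by rintro rfl; simp at hw)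
    have hq : q.length = n := by simpa using hw
    subst hq
    refine (WordSeries.sum_apply _ _ _).trans ?_
    rw [dynkin_cons_concat, Finset.sum_sub_distrib]
    simp

end IsLeadingTerm

/-- Level-by-level surjectivity: a functional satisfying the shuffle relations up to degree `N`
agrees up to degree `N` with a product of exponentials of letters. -/
lemma exists_isExpProduct (N : ℕ) {x : WordSeries (Fin d)} (hx1 : x [] = 1)
    (hx : ∀ u v : List (Fin d), u.length + v.length ≤ N → x u * x v = shuffleSum x u v) :
    ∃ g, IsExpProduct g ∧ ∀ w : List (Fin d), w.length ≤ N → g w = x w := by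
  induction N with
  | zero =>
    refine ⟨1, .one, fun w hw => ?_⟩
    obtain rfl := List.length_eq_zero_iff.1 (Nat.le_zero.1 hw)
    simp [hx1]
  | succ N ih =>
    obtain ⟨g, hg, hgx⟩ := ih fun u v h => hx u v (by omega)
    obtain ⟨k, hk, hkv, hkw⟩ := IsLeadingTerm.dynkin N (((N : ℝ) + 1)⁻¹ • (x - g))
    have hkx : ∀ w : List (Fin d), w.length = N + 1 → k w = x w - g w := by
      intro w hw
      rw [hkw w hw, dynkin_eq_length_mul, hw, smul_apply, sub_apply]
      · push_cast
        field_simp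
      · intro u v hu hv huv
        have := List.length_pos_iff.2 hu
        have := List.length_pos_iff.2 hv
        rw [shuffleSum_smul_sub, ← hx u v (by omega), hg.shuffleSum_eq, hgx u (by omega),
          hgx v (by omega), sub_self, mul_zero]
    have e : g * k = g + g * (k - 1) := by noncomm_ring
    refine ⟨g * k, hg.mul hk, fun w hw => ?_⟩
    rw [e, add_apply]
    rcases hw.lt_or_eq with hlt | heq
    · rw [(vanishesBelow_zero g).mul hkv w (by omega), hgx w (by omega), add_zero]
    · rw [(vanishesBelow_zero g).mul_apply hkv (by omega), List.take_zero, List.drop_zero,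
        hg.apply_nil, sub_apply, one_apply_of_length_pos (by omega), hkx w heq]
      ring

end Signature

section ShuffleWord

open WordSeries

variable {α : Type*}

/-- `shuffleWord` with the number of positions decoupled from the lengths of the words. -/
def interleave (k : ℕ) (u v : List α) (s : Finset (Fin k)) : List α :=
  (List.finRange k).filterMap fun p =>
    if p ∈ s then u[(s.filter (fun q => q < p)).card]?
    else v[((sᶜ : Finset (Fin k)).filter (fun q => q < p)).card]?

lemma card_filter_lt_succ {k : ℕ} (s : Finset (Fin (k + 1))) (p : Fin k) :
    (s.filter (fun q => q < p.succ)).card =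
      (if 0 ∈ s then 1 else 0) +
        ((Finset.univ.filter fun q : Fin k => q.succ ∈ s).filter (fun q => q < p)).card := by
  have h1 : s.filter (fun q => q < p.succ) = Finset.univ.filter fun q => q ∈ s ∧ q < p.succ := by
    ext; simp
  rw [h1, Fin.card_filter_univ_succ]
  simp only [Fin.succ_pos, and_true, Fin.succ_lt_succ_iff, Finset.filter_filter]
  split_ifs <;> simp [add_comm]

lemma interleave_succ_of_mem {k : ℕ} (a : α) (u v : List α) (s : Finset (Fin k)) :
    interleave (k + 1) (a :: u) v (insert 0 (s.map (Fin.succEmb k))) =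
      a :: interleave k u v s := by
  have h1 : (Finset.univ.filter fun q : Fin k =>
      q.succ ∈ insert 0 (s.map (Fin.succEmb k))) = s := by
    ext q; simp [Fin.succ_ne_zero]
  have h2 : (Finset.univ.filter fun q : Fin k =>
      q.succ ∈ (insert 0 (s.map (Fin.succEmb k)))ᶜ) = sᶜ := by
    ext q; simp [Fin.succ_ne_zero]
  unfold interleave
  rw [List.finRange_succ, List.filterMap_cons, List.filterMap_map]
  simp only [Finset.mem_insert_self, if_true, Fin.not_lt_zero, Finset.filter_false,
    Finset.card_empty, List.getElem?_cons_zero]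
  congr 2
  funext p
  simp only [Function.comp_apply, card_filter_lt_succ, h1, h2]
  simp [Fin.succ_ne_zero, add_comm 1]

lemma interleave_succ_of_notMem {k : ℕ} (b : α) (u v : List α) (s : Finset (Fin k)) :
    interleave (k + 1) u (b :: v) (s.map (Fin.succEmb k)) = b :: interleave k u v s := by
  have h1 : (Finset.univ.filter fun q : Fin k => q.succ ∈ s.map (Fin.succEmb k)) = s := by
    ext q; simp
  have h2 : (Finset.univ.filter fun q : Fin k => q.succ ∈ (s.map (Fin.succEmb k))ᶜ) = sᶜ := by
    ext q; simp
  have h0 : (0 : Fin (k + 1)) ∉ s.map (Fin.succEmb k) := by simp [Fin.succ_ne_zero]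
  unfold interleave
  rw [List.finRange_succ, List.filterMap_cons, List.filterMap_map]
  simp only [h0, if_false, Fin.not_lt_zero, Finset.filter_false, Finset.card_empty,
    List.getElem?_cons_zero]
  congr 2
  funext p
  simp only [Function.comp_apply, card_filter_lt_succ, h1, h2]
  simp [Fin.succ_ne_zero, add_comm 1]

lemma sum_powersetCard_succ {k n : ℕ} (f : Finset (Fin (k + 1)) → ℝ) :
    ∑ s ∈ Finset.powersetCard (n + 1) (Finset.univ : Finset (Fin (k + 1))), f s =
      ∑ s ∈ Finset.powersetCard n (Finset.univ : Finset (Fin k)),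
          f (insert 0 (s.map (Fin.succEmb k))) +
        ∑ s ∈ Finset.powersetCard (n + 1) (Finset.univ : Finset (Fin k)),
          f (s.map (Fin.succEmb k)) := by
  have h0 : (0 : Fin (k + 1)) ∉ Finset.univ.map (Fin.succEmb k) := by simp [Fin.succ_ne_zero]
  have hu : (Finset.univ : Finset (Fin (k + 1))) = insert 0 (Finset.univ.map (Fin.succEmb k)) := by
    ext q; cases q using Fin.cases <;> simp
  rw [hu, Finset.powersetCard_succ_insert h0, Finset.sum_union, add_comm, Finset.sum_image,
    Finset.powersetCard_map, Finset.powersetCard_map, Finset.sum_map, Finset.sum_map]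
  · rfl
  · intro s hs t ht hst
    have hs' := fun h => h0 ((Finset.mem_powersetCard.1 hs).1 h)
    have ht' := fun h => h0 ((Finset.mem_powersetCard.1 ht).1 h)
    rw [← Finset.erase_insert hs', ← Finset.erase_insert ht', hst]
  · refine Finset.disjoint_left.2 fun s hs ht => ?_
    obtain ⟨t, -, rfl⟩ := Finset.mem_image.1 ht
    exact h0 ((Finset.mem_powersetCard.1 hs).1 (Finset.mem_insert_self _ _))

lemma interleave_nil_left (v : List α) : interleave v.length [] v ∅ = v := by
  induction v with
  | nil => rfl
  | cons b v ih => simpa [ih] using interleave_succ_of_notMem b [] v (∅ : Finset (Fin v.length))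

lemma interleave_nil_right (u : List α) : interleave u.length u [] Finset.univ = u := by
  induction u with
  | nil => rfl
  | cons a u ih =>
    have hu : (Finset.univ : Finset (Fin (u.length + 1))) =
        insert 0 (Finset.univ.map (Fin.succEmb u.length)) := by
      ext q; cases q using Fin.cases <;> simp
    rw [List.length_cons, hu, interleave_succ_of_mem, ih]

lemma sum_interleave (x : WordSeries α) (u v : List α) (k : ℕ) (hk : u.length + v.length = k) :
    ∑ s ∈ Finset.powersetCard u.length (Finset.univ : Finset (Fin k)), x (interleave k u v s) =
      shuffleSum x u v := by
  induction u, v using shuffle_induction generalizing x k with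
  | nil_left v =>
    obtain rfl : v.length = k := by simpa using hk
    simp [interleave_nil_left]
  | nil_right u =>
    obtain rfl : u.length = k := by simpa using hk
    have h := Finset.powersetCard_self (Finset.univ : Finset (Fin u.length))
    rw [Finset.card_univ, Fintype.card_fin] at h
    simp [h, interleave_nil_right]
  | cons_cons a u b v h₁ h₂ =>
    obtain ⟨k, rfl⟩ : ∃ l, k = l + 1 := ⟨u.length + v.length + 1, by simp at hk; omega⟩
    rw [List.length_cons, sum_powersetCard_succ, shuffleSum_cons_cons,
      ← h₁ (shift a x) k (by simp at hk ⊢; omega), ← h₂ (shift b x) k (by simp at hk ⊢; omega)]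
    simp only [interleave_succ_of_mem, interleave_succ_of_notMem]
    rfl

end ShuffleWord

/-- Chow–Rashevskii surjectivity onto truncated grouplike elements: any
real-valued function on words of length at most `N` with `x(∅) = 1` satisfying
the truncated shuffle relations is the level-`N` truncated signature of some
C¹ path `γ : [0,1] → ℝ^d`. -/
theorem truncated_signature_surjective {d : ℕ} (hd : 1 ≤ d) (N : ℕ)
    (x : List (Fin d) → ℝ) (hx1 : x [] = 1)
    (hshuffle : ∀ u v : List (Fin d), u.length + v.length ≤ N →
      x u * x v =
        ∑ s ∈ Finset.powersetCard u.length
            (Finset.univ : Finset (Fin (u.length + v.length))),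
          x (shuffleWord u v s)) :
    ∃ γ : ℝ → EuclideanSpace ℝ (Fin d), ContDiff ℝ 1 γ ∧
      ∀ w : List (Fin d), w.length ≤ N → sig γ w 0 1 = x w := by
  obtain ⟨g, hg, hgx⟩ := exists_isExpProduct N hx1 fun u v h =>
    (hshuffle u v h).trans (sum_interleave x u v _ rfl)
  obtain ⟨γ, hγ, -, -, rfl⟩ := hg.exists_path zero_lt_one
  exact ⟨γ, hγ, hgx⟩
end
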